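/- arXiv:1607.04873 — 2 statements merged into one kernel-verified Lean document; each statement's English description precedes it below -/
import Mathlib

section
/- Let K be a field and n ≥ 1, d ≥ 0 integers. If M is a uniform determinantal representation of p_{n,d} of size N, then N²·n + N ≥ binom(n+d, n), i.e., N²·n + N is at least the dimension of the space F_d of polynomials of degree at most d in n variables. -/
open MvPolynomial

/-- Exponent vectors in `n` variables of total degree at most `d`. -/
def ExpLE (n d : ℕ) : Type := {α : Fin n →₀ ℕ // (α.sum fun _ e => e) ≤ d}

noncomputable instance (n d : ℕ) : Fintype (ExpLE n d) := by
  have key : ∀ α : ExpLE n d, ∀ i, α.1 i < d + 1 := by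
    intro α i
    refine Nat.lt_succ_of_le (le_trans ?_ α.2)
    by_cases h : α.1 i = 0
    · simp [h]
    · rw [Finsupp.sum]
      exact Finset.single_le_sum (f := fun j => α.1 j) (fun _ _ => Nat.zero_le _)
        (Finsupp.mem_support_iff.mpr h)
  exact Fintype.ofInjective (fun α : ExpLE n d => fun i => (⟨α.1 i, key α i⟩ : Fin (d+1)))
    (fun α β h => Subtype.ext (Finsupp.ext fun i => congrArg Fin.val (congrFun h i)))

instance (n d : ℕ) : DecidableEq (ExpLE n d) := by
  unfold ExpLE; infer_instance

/-- The ring `R = K[x₁,…,xₙ,(c_α)_{|α|≤d}]`. -/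
abbrev URing (K : Type*) [Field K] (n d : ℕ) := MvPolynomial (Fin n ⊕ ExpLE n d) K

/-- The generic polynomial `p_{n,d} = Σ_{|α|≤d} c_α x^α`. -/
noncomputable def genPoly (K : Type*) [Field K] (n d : ℕ) : URing K n d :=
  ∑ α : ExpLE n d, X (Sum.inr α) * ∏ i : Fin n, X (Sum.inl i) ^ (α.1 i)

/-- The monomials `1, xᵢ, c_α, c_α xᵢ`. -/
def allowedMonomials (K : Type*) [Field K] (n d : ℕ) : Set (URing K n d) :=
  {1} ∪ (Set.range fun i : Fin n => (X (Sum.inl i) : URing K n d))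
    ∪ (Set.range fun α : ExpLE n d => (X (Sum.inr α) : URing K n d))
    ∪ (Set.range fun p : ExpLE n d × Fin n =>
        (X (Sum.inr p.1) * X (Sum.inl p.2) : URing K n d))

/-- A uniform determinantal representation of `p_{n,d}` of size `N`. -/
def IsUDR (K : Type*) [Field K] (n d N : ℕ)
    (M : Matrix (Fin N) (Fin N) (URing K n d)) : Prop :=
  (∀ i j, M i j ∈ Submodule.span K (allowedMonomials K n d)) ∧
    M.det = genPoly K n d

/-- `N*(n,d)`: the minimal size of a uniform determinantal representation. -/
noncomputable def Nstar (K : Type*) [Field K] (n d : ℕ) : ℕ :=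
  sInf {N : ℕ | ∃ M : Matrix (Fin N) (Fin N) (URing K n d), IsUDR K n d N M}

/-- Setting all the `c_α` to zero: `M ↦ M₀` entrywise. -/
noncomputable def killC (K : Type*) [Field K] (n d : ℕ) :
    URing K n d →ₐ[K] MvPolynomial (Fin n) K :=
  aeval (Sum.elim X fun _ => 0)

/-- A subspace `V ⊆ K[x₁,…,xₙ]` is connected to 1. -/
def ConnectedToOne (K : Type*) [Field K] (n : ℕ)
    (V : Submodule K (MvPolynomial (Fin n) K)) : Prop :=
  V ≠ ⊥ ∧ ∀ e : ℕ,
    V ⊓ restrictTotalDegree (Fin n) K (e + 1) ≤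
      restrictTotalDegree (Fin n) K 1 * (V ⊓ restrictTotalDegree (Fin n) K e)


theorem Derivation.leibniz_finset_prod {R A M ι : Type*} [CommSemiring R] [CommSemiring A]
    [AddCommMonoid M] [Algebra R A] [Module A M] [Module R M] [DecidableEq ι]
    (D : Derivation R A M) (s : Finset ι) (f : ι → A) :
    D (∏ i ∈ s, f i) = ∑ i ∈ s, (∏ j ∈ s.erase i, f j) • D (f i) := by
  induction s using Finset.induction_on with
  | empty => simp
  | insert a s ha ih =>
    rw [Finset.prod_insert ha, D.leibniz, ih, Finset.sum_insert ha, Finset.erase_insert ha,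
      add_comm, Finset.smul_sum]
    congr 1
    refine Finset.sum_congr rfl fun i hi => ?_
    rw [Finset.erase_insert_of_ne (by rintro rfl; exact ha hi),
      Finset.prod_insert (fun h => ha (Finset.mem_of_mem_erase h)), smul_smul]

/-- Jacobi's formula for an arbitrary derivation. -/
theorem Derivation.map_det {R A ι : Type*} [CommRing R] [CommRing A] [Algebra R A]
    [Fintype ι] [DecidableEq ι] (D : Derivation R A A) (M : Matrix ι ι A) :
    D M.det = ∑ i, ∑ k, M.adjugate i k * D (M k i) := by
  have h : ∀ i, ∑ k, M.adjugate i k * D (M k i) = (M.updateCol i fun k => D (M k i)).det := by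
    intro i
    rw [← Matrix.cramer_apply, Matrix.cramer_eq_adjugate_mulVec]
    rfl
  simp_rw [h, Matrix.det_apply, map_sum]
  rw [Finset.sum_comm]
  refine Finset.sum_congr rfl fun σ _ => ?_
  rw [← Finset.smul_sum, Units.smul_def, Units.smul_def, map_zsmul, D.leibniz_finset_prod]
  congr 1
  refine Finset.sum_congr rfl fun i _ => ?_
  rw [← Finset.mul_prod_erase _ _ (Finset.mem_univ i), Matrix.updateCol_self, smul_eq_mul,
    mul_comm]
  congr 1
  refine Finset.prod_congr rfl fun j hj => ?_
  rw [Matrix.updateCol_ne (Finset.ne_of_mem_erase hj)]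

/-- The affine linear forms, i.e. the span of `1` and the variables. -/
noncomputable def affineForms (K : Type*) [Field K] (n : ℕ) :
    Submodule K (MvPolynomial (Fin n) K) :=
  Submodule.span K (insert 1 (Set.range X))

section AffineMatrix

variable {K : Type*} [Field K] {n N : ℕ}

theorem one_mem_affineForms : (1 : MvPolynomial (Fin n) K) ∈ affineForms K n :=
  Submodule.subset_span (Set.mem_insert _ _)

theorem X_mem_affineForms (i : Fin n) : (X i : MvPolynomial (Fin n) K) ∈ affineForms K n :=
  Submodule.subset_span (Set.mem_insert_of_mem _ ⟨i, rfl⟩)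

/-- The products of the variables with the entries of `B`, followed by the entries in row `k`
of `B`. -/
noncomputable def shiftsAndRow (B : Matrix (Fin N) (Fin N) (MvPolynomial (Fin n) K))
    (k : Fin N) : ((Fin N × Fin N) × Fin n) ⊕ Fin N → MvPolynomial (Fin n) K :=
  Sum.elim (fun p => X p.2 * B p.1.1 p.1.2) fun j => B k j

theorem mul_sub_constantCoeff_smul_mem
    (B : Matrix (Fin N) (Fin N) (MvPolynomial (Fin n) K)) (k i j : Fin N)
    {f : MvPolynomial (Fin n) K} (hf : f ∈ affineForms K n) :
    f * B i j - constantCoeff f • B i j ∈ Submodule.span K (Set.range (shiftsAndRow B k)) := by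
  induction hf using Submodule.span_induction with
  | mem f hf =>
    obtain rfl | ⟨m, rfl⟩ := hf
    · simp
    · rw [constantCoeff_X, zero_smul, sub_zero]
      exact Submodule.subset_span ⟨Sum.inl ((i, j), m), rfl⟩
  | zero => simp
  | add f g _ _ hf hg =>
    convert add_mem hf hg using 1
    rw [map_add, add_mul, add_smul]
    abel
  | smul c f _ hf =>
    convert Submodule.smul_mem _ c hf using 1
    rw [smul_sub, smul_mul_assoc, smul_smul, constantCoeff_smul, smul_eq_mul]

/-- If the affine linear matrix `A` annihilates `B` and its constant part is invertible after
replacing row `l` by the `k`-th unit vector, then the entries of `B` lie in the span of the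
`shiftsAndRow`. -/
theorem entry_mem_span_shiftsAndRow {A B : Matrix (Fin N) (Fin N) (MvPolynomial (Fin n) K)}
    (hA : ∀ i j, A i j ∈ affineForms K n) (hAB : A * B = 0) {k l : Fin N}
    (hkl : (A.map constantCoeff).adjugate k l ≠ 0) (i j : Fin N) :
    B i j ∈ Submodule.span K (Set.range (shiftsAndRow B k)) := by
  set U := Submodule.span K (Set.range (shiftsAndRow B k))
  set A' := (A.map constantCoeff).updateRow l (Pi.single k 1) with hA'
  have hdet : IsUnit A'.det := by
    rw [Matrix.adjugate_apply] at hkl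
    exact hkl.isUnit
  have hrow : ∀ m, ∑ s, A' m s • B s j ∈ U := by
    intro m
    obtain rfl | hm := eq_or_ne m l
    · simp only [hA', Matrix.updateRow_self, Pi.single_apply, ite_smul, one_smul, zero_smul,
        Finset.sum_ite_eq', Finset.mem_univ, if_true]
      exact Submodule.subset_span ⟨Sum.inr j, rfl⟩
    · have h0 : ∑ s, A m s * B s j = 0 := by
        rw [← Matrix.mul_apply, hAB, Matrix.zero_apply]
      have h1 := Submodule.sum_mem U fun s (_ : s ∈ Finset.univ) =>
        mul_sub_constantCoeff_smul_mem B k s j (hA m s)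
      rw [Finset.sum_sub_distrib, h0, zero_sub, Submodule.neg_mem_iff] at h1
      simpa [hA', Matrix.updateRow_ne hm] using h1
  have key : B i j = ∑ m, A'⁻¹ i m • ∑ s, A' m s • B s j := by
    simp_rw [Finset.smul_sum, smul_smul]
    rw [Finset.sum_comm]
    simp_rw [← Finset.sum_smul, ← Matrix.mul_apply, Matrix.nonsing_inv_mul _ hdet,
      Matrix.one_apply, ite_smul, one_smul, zero_smul]
    simp
  rw [key]
  exact Submodule.sum_mem _ fun m _ => Submodule.smul_mem _ _ (hrow m)

end AffineMatrix

section AllowedMonomials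

variable {K : Type*} [Field K] {n d : ℕ}

theorem killC_mem_affineForms {f : URing K n d}
    (hf : f ∈ Submodule.span K (allowedMonomials K n d)) :
    killC K n d f ∈ affineForms K n := by
  suffices h : Submodule.span K (allowedMonomials K n d) ≤
      (affineForms K n).comap (killC K n d).toLinearMap from h hf
  rw [Submodule.span_le]
  rintro _ (((rfl | ⟨i, rfl⟩) | ⟨α, rfl⟩) | ⟨⟨α, i⟩, rfl⟩)
  · simpa using one_mem_affineForms
  · simpa [killC] using X_mem_affineForms i
  · simp [killC]
  · simp [killC]

theorem killC_pderiv_mem_affineForms (α : ExpLE n d) {f : URing K n d}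
    (hf : f ∈ Submodule.span K (allowedMonomials K n d)) :
    killC K n d (pderiv (Sum.inr α) f) ∈ affineForms K n := by
  suffices h : Submodule.span K (allowedMonomials K n d) ≤
      (affineForms K n).comap ((killC K n d).toLinearMap ∘ₗ (pderiv (Sum.inr α)).toLinearMap)
    from h hf
  rw [Submodule.span_le]
  rintro _ (((rfl | ⟨i, rfl⟩) | ⟨β, rfl⟩) | ⟨⟨β, i⟩, rfl⟩)
  · simp
  · simp [pderiv_X]
  · obtain rfl | h := eq_or_ne β α
    · simpa using one_mem_affineForms
    · simp [pderiv_X, h]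
  · obtain rfl | h := eq_or_ne β α
    · simpa [killC, pderiv_X, Pi.single_apply] using X_mem_affineForms i
    · simp [killC, pderiv_X, h]

theorem killC_genPoly : killC K n d (genPoly K n d) = 0 := by
  simp [killC, genPoly]

theorem killC_pderiv_genPoly (α : ExpLE n d) :
    killC K n d (pderiv (Sum.inr α) (genPoly K n d)) = monomial α.1 1 := by
  have h : ∀ β : ExpLE n d, pderiv (Sum.inr α)
      (∏ i : Fin n, X (Sum.inl i) ^ (β.1 i) : URing K n d) = 0 := by
    intro β
    rw [Derivation.leibniz_finset_prod]
    refine Finset.sum_eq_zero fun i _ => ?_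
    simp [Derivation.leibniz_pow, pderiv_X]
  have h' : ∀ β : ExpLE n d, killC K n d (pderiv (Sum.inr α)
      (X (Sum.inr β) * ∏ i : Fin n, X (Sum.inl i) ^ (β.1 i))) =
        if β = α then monomial β.1 1 else 0 := by
    intro β
    rw [Derivation.leibniz, h, pderiv_X, smul_zero, zero_add]
    split_ifs with hβ
    · subst hβ
      simp [killC, monomial_eq, Finsupp.prod_fintype]
    · simp [hβ]
  rw [genPoly, map_sum, map_sum]
  simp_rw [h']
  simp

end AllowedMonomials

theorem choose_le_card_expLE (n d : ℕ) : (n + d).choose n ≤ Fintype.card (ExpLE n d) := by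
  have hcard : ((Finset.univ : Finset (Option (Fin n))).finsuppAntidiag d).card =
      (n + d).choose n := by
    rw [Finset.card_finsuppAntidiag_nat_eq_choose, Finset.card_univ, Fintype.card_option,
      Fintype.card_fin, Nat.add_right_comm, Nat.add_sub_cancel, Nat.choose_symm_add]
  have hsum : ∀ P : (Finset.univ : Finset (Option (Fin n))).finsuppAntidiag d,
      P.1 none + P.1.some.sum (fun _ e => e) = d := by
    intro P
    have h := (Finset.mem_finsuppAntidiag.mp P.2).1
    rw [Fintype.sum_option] at h
    rwa [Finsupp.sum_fintype _ _ fun _ => rfl]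
  rw [← hcard, ← Fintype.card_coe]
  refine Fintype.card_le_of_injective
    (fun P => (⟨P.1.some, (Nat.le_add_left _ _).trans (hsum P).le⟩ : ExpLE n d)) fun P Q h => ?_
  have hPQ : P.1.some = Q.1.some := congrArg Subtype.val h
  have hP : P.1 none = Q.1 none := by
    have hP := hsum P
    have hQ := hsum Q
    rw [hPQ] at hP
    omega
  refine Subtype.ext (Finsupp.ext fun a => ?_)
  cases a with
  | none => exact hP
  | some a => exact DFunLike.congr_fun hPQ a

/-- If `M` is a uniform determinantal representation of `p_{n,d}` of size `N`,
then `N²·n + N ≥ binom(n+d, n) = dim F_d`. -/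
theorem udr_size_inequality (K : Type*) [Field K] (n d : ℕ) (hn : 1 ≤ n) (N : ℕ)
    (M : Matrix (Fin N) (Fin N) (URing K n d)) (hM : IsUDR K n d N M) :
    (n + d).choose n ≤ N ^ 2 * n + N := by
  obtain ⟨hspan, hdet⟩ := hM
  set A : Matrix (Fin N) (Fin N) (MvPolynomial (Fin n) K) :=
    (killC K n d).mapMatrix M with hA
  have hadj : A.adjugate = (killC K n d).mapMatrix M.adjugate :=
    ((killC K n d).map_adjugate M).symm
  have hmul : A * A.adjugate = 0 := by
    rw [Matrix.mul_adjugate, hA, ← AlgHom.map_det, hdet, killC_genPoly, zero_smul]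
  have hmon : ∀ α : ExpLE n d, (monomial α.1 1 : MvPolynomial (Fin n) K) =
      ∑ i, ∑ k, A.adjugate i k * killC K n d (pderiv (Sum.inr α) (M k i)) := by
    intro α
    rw [← killC_pderiv_genPoly, ← hdet, Derivation.map_det]
    simp [hadj]
  obtain ⟨k, l, hkl⟩ : ∃ k l, (A.map constantCoeff).adjugate k l ≠ 0 := by
    by_contra! h
    have hc : ∀ i k, constantCoeff (A.adjugate i k) = 0 := by
      intro i k
      rw [← h i k]
      exact congrFun (congrFun ((constantCoeff (σ := Fin n) (R := K)).map_adjugate A) i) k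
    have := congrArg constantCoeff (hmon ⟨0, by simp⟩)
    simp [hc] at this
  set U := Submodule.span K (Set.range (shiftsAndRow A.adjugate k))
  have hB := entry_mem_span_shiftsAndRow
    (fun i j => killC_mem_affineForms (hspan i j)) hmul hkl
  have hmem : ∀ α : ExpLE n d, (monomial α.1 1 : MvPolynomial (Fin n) K) ∈ U := by
    intro α
    rw [hmon]
    refine Submodule.sum_mem _ fun i _ => Submodule.sum_mem _ fun j _ => ?_
    have h := mul_sub_constantCoeff_smul_mem A.adjugate k i j
      (killC_pderiv_mem_affineForms α (hspan j i))
    rw [mul_comm]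
    exact (Submodule.sub_mem_iff_left _ (Submodule.smul_mem _ _ (hB i j))).mp h
  have hli : LinearIndependent K
      fun α : ExpLE n d => (⟨monomial α.1 1, hmem α⟩ : U) := by
    refine LinearIndependent.of_comp U.subtype ?_
    have := (basisMonomials (Fin n) K).linearIndependent.comp
      (Subtype.val : ExpLE n d → _) Subtype.val_injective
    rwa [coe_basisMonomials] at this
  have : Module.Finite K U := Module.Finite.span_of_finite K (Set.finite_range _)
  calc (n + d).choose n ≤ Fintype.card (ExpLE n d) := choose_le_card_expLE n d
    _ ≤ Module.finrank K U := hli.fintype_card_le_finrank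
    _ ≤ _ := finrank_range_le_card _
    _ = N ^ 2 * n + N := by simp [sq]
end

section
/- Let K be a field and fix an integer n ≥ 1. There exists a constant C > 0 (depending on n but not on d) such that for every integer d ≥ 1 there is a uniform determinantal representation M = M₀ + M₁ of p_{n,d} of size N with N ≤ dⁿ/(n·n!) + C·d^{n−1}, and such that moreover some nonzero vector u ∈ Kᴺ satisfies uᵀM₀ = 0 identically (i.e., M₀ has, after a basis change, a row that is identically zero; the singular matrix space spanned by the coefficient matrices of M₀ is a compression space with a one-dimensional witness). -/
open MvPolynomial

section Determinant

variable {ι R : Type*} [Fintype ι] [DecidableEq ι] [CommRing R]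

theorem det_eq_one_of_graded_unitriangular (A : Matrix ι ι R) (b : ι → ℕ)
    (hdiag : ∀ i, A i i = 1) (hlow : ∀ i j, i ≠ j → b i ≤ b j → A i j = 0) : A.det = 1 := by
  have hT : A.BlockTriangular (fun i => OrderDual.toDual (b i)) := by
    intro i j hij
    have hij : b i < b j := hij
    exact hlow i j (by rintro rfl; exact lt_irrefl _ hij) hij.le
  rw [hT.det]
  refine Finset.prod_eq_one fun a _ => ?_
  have : A.toSquareBlock (fun i => OrderDual.toDual (b i)) a = 1 := by
    ext ⟨i, hi⟩ ⟨j, hj⟩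
    by_cases h : i = j
    · subst h; simp [Matrix.toSquareBlock_def, hdiag]
    · rw [Matrix.one_apply_ne (by simpa using h)]
      exact hlow i j h (OrderDual.toDual.injective (hi.trans hj.symm)).le
  rw [this, Matrix.det_one]

theorem det_eq_of_mulVec_eq_single (A : Matrix ι ι R) (b : ι → ℕ) (o : ι) (v : ι → R) (p : R)
    (hv : A.mulVec v = Pi.single o p) (hvo : v o = 1) (hbo : b o = 0)
    (hdiag : ∀ i, i ≠ o → A i i = 1)
    (hlow : ∀ i j, i ≠ o → i ≠ j → b i ≤ b j → A i j = 0) : A.det = p := by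
  have hadj : A.adjugate o o = 1 := by
    rw [Matrix.adjugate_apply]
    refine det_eq_one_of_graded_unitriangular _ b (fun i => ?_) fun i j hij hb => ?_
    · by_cases h : i = o
      · subst h; simp
      · simp [Matrix.updateRow_ne h, hdiag i h]
    · by_cases h : i = o
      · subst h; simp [Ne.symm hij]
      · simp [Matrix.updateRow_ne h, hlow i j h hij hb]
  have h := congrFun (congrArg A.adjugate.mulVec hv) o
  rw [Matrix.mulVec_mulVec, Matrix.adjugate_mul, Matrix.smul_mulVec, Matrix.one_mulVec] at h
  simpa [hvo, hadj, Matrix.mulVec_single] using h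

end Determinant

section Construction

variable (K : Type*) [Field K] {n d : ℕ}

/-- The monomial `x^a` in the ring `R`. -/
noncomputable def xMonomial (d : ℕ) (a : Fin n →₀ ℕ) : URing K n d :=
  ∏ i : Fin n, X (Sum.inl i) ^ a i

theorem xMonomial_add_single (a : Fin n →₀ ℕ) (k : Fin n) :
    xMonomial K d (a + Finsupp.single k 1) = X (Sum.inl k) * xMonomial K d a := by
  simp only [xMonomial, Finsupp.add_apply, pow_add, Finset.prod_mul_distrib]
  rw [mul_comm]
  congr 1
  rw [Finset.prod_eq_single k]
  · simp
  · intro j _ hj; simp [Finsupp.single_eq_of_ne hj]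
  · simp

/-- A finite set of monomials that is connected to `1` by divisions by variables, and whose
multiples by `1, x₁, …, xₙ` cover all monomials of degree at most `d`, yields a uniform
determinantal representation whose constant part has a zero row. -/
theorem exists_isUDR_of_connected_cover [NeZero n] {ι : Type*} [Fintype ι]
    (m : ι → Fin n →₀ ℕ) (o : ι) (ho : m o = 0)
    (hconn : ∀ i, i ≠ o → ∃ j k, m i = m j + Finsupp.single k 1)
    (hcover : ∀ α : ExpLE n d, ∃ i, α.1 = m i ∨ ∃ k, α.1 = m i + Finsupp.single k 1) :
    ∃ M : Matrix (Fin (Fintype.card ι)) (Fin (Fintype.card ι)) (URing K n d),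
      IsUDR K n d (Fintype.card ι) M ∧
      ∃ u : Fin (Fintype.card ι) → K, u ≠ 0 ∧
        Matrix.vecMul (fun i => (MvPolynomial.C (u i) : MvPolynomial (Fin n) K))
          (M.map (killC K n d)) = 0 := by
  classical
  have hconn' : ∀ i, ∃ jk : ι × Fin n, i ≠ o → m i = m jk.1 + Finsupp.single jk.2 1 := by
    intro i
    by_cases h : i = o
    · exact ⟨(o, 0), fun h' => absurd h h'⟩
    · obtain ⟨j, k, e⟩ := hconn i h
      exact ⟨(j, k), fun _ => e⟩
  choose par hpar using hconn'
  have hcover' : ∀ α : ExpLE n d, ∃ (i : ι) (f : URing K n d),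
      xMonomial K d α.1 = f * xMonomial K d (m i) ∧ (f = 1 ∨ ∃ k, f = X (Sum.inl k)) := by
    intro α
    obtain ⟨i, h | ⟨k, h⟩⟩ := hcover α
    · exact ⟨i, 1, by rw [h, one_mul], Or.inl rfl⟩
    · exact ⟨i, X (Sum.inl k), by rw [h, xMonomial_add_single], Or.inr ⟨k, rfl⟩⟩
  choose q f hq hf using hcover'
  let A : Matrix ι ι (URing K n d) := fun i j =>
    if i = o then ∑ α : ExpLE n d, if j = q α then X (Sum.inr α) * f α else 0
    else (if j = i then 1 else 0) - if j = (par i).1 then X (Sum.inl (par i).2) else 0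
  have hAo : ∀ j, A o j = ∑ α : ExpLE n d, if j = q α then X (Sum.inr α) * f α else 0 :=
    fun j => if_pos rfl
  have hA : ∀ i j, i ≠ o → A i j =
      (if j = i then 1 else 0) - if j = (par i).1 then X (Sum.inl (par i).2) else 0 :=
    fun i j h => if_neg h
  have hdeg : ∀ i, i ≠ o → (m (par i).1).degree < (m i).degree := by
    intro i hi
    conv_rhs => rw [hpar i hi]
    simp
  have hdet : A.det = genPoly K n d := by
    refine det_eq_of_mulVec_eq_single A (fun i => (m i).degree) o (fun i => xMonomial K d (m i))
      _ ?_ ?_ ?_ ?_ ?_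
    · ext1 i
      by_cases hi : i = o
      · subst hi
        simp only [Matrix.mulVec, dotProduct, hAo, Pi.single_eq_same, Finset.sum_mul, genPoly]
        rw [Finset.sum_comm]
        refine Finset.sum_congr rfl fun α _ => ?_
        simp only [ite_mul, zero_mul, Finset.sum_ite_eq', Finset.mem_univ, if_true, mul_assoc,
          ← hq]
        rfl
      · simp only [Matrix.mulVec, dotProduct, hA i _ hi, sub_mul, ite_mul, one_mul, zero_mul,
          Finset.sum_sub_distrib, Finset.sum_ite_eq', Finset.mem_univ, if_true,
          Pi.single_eq_of_ne hi]
        rw [← xMonomial_add_single, ← hpar i hi, sub_self]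
    · simp [xMonomial, ho]
    · simp [ho]
    · intro i hi
      have : i ≠ (par i).1 := fun h => (hdeg i hi).ne (by rw [← h])
      simp [hA i i hi, this]
    · intro i j hi hij hb
      have : j ≠ (par i).1 := by
        rintro rfl
        exact absurd (hdeg i hi) (not_lt.2 hb)
      simp [hA i j hi, this, Ne.symm hij]
  have hspan : ∀ i j, A i j ∈ Submodule.span K (allowedMonomials K n d) := by
    intro i j
    by_cases hi : i = o
    · subst hi
      rw [hAo]
      refine Submodule.sum_mem _ fun α _ => ?_
      split_ifs
      · refine Submodule.subset_span ?_
        rcases hf α with h | ⟨k, h⟩ <;> rw [h]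
        · exact Or.inl (Or.inr ⟨α, (mul_one _).symm⟩)
        · exact Or.inr ⟨(α, k), rfl⟩
      · exact Submodule.zero_mem _
    · rw [hA i j hi]
      refine Submodule.sub_mem _ ?_ ?_ <;> split_ifs
      · exact Submodule.subset_span (Or.inl (Or.inl (Or.inl rfl)))
      · exact Submodule.zero_mem _
      · exact Submodule.subset_span (Or.inl (Or.inl (Or.inr ⟨_, rfl⟩)))
      · exact Submodule.zero_mem _
  let e := Fintype.equivFin ι
  refine ⟨A.submatrix e.symm e.symm, ⟨fun i j => hspan _ _, ?_⟩, Pi.single (e o) 1, ?_, ?_⟩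
  · rw [Matrix.det_submatrix_equiv_self, hdet]
  · simp
  · ext1 j
    simp only [Matrix.vecMul, dotProduct, Matrix.map_apply, Matrix.submatrix_apply, Pi.zero_apply]
    rw [Finset.sum_eq_single (e o)]
    · simp [hAo, killC, apply_ite]
    · intro i _ hi
      simp [Pi.single_eq_of_ne hi]
    · simp

end Construction

section Counting

variable {n d : ℕ}

theorem ExpLE.degree_le (α : ExpLE n d) : ∑ i, α.1 i ≤ d := by
  have h := α.2
  rwa [Finsupp.sum_fintype _ _ (fun _ => rfl)] at h

/-- An exponent vector of bounded total degree, as an element of `ExpLE`. -/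
def ExpLE.ofLE (a : Fin n →₀ ℕ) (h : ∑ i, a i ≤ d) : ExpLE n d :=
  ⟨a, by rwa [Finsupp.sum_fintype _ _ (fun _ => rfl)]⟩

theorem card_expLE_le_choose (n d : ℕ) : Fintype.card (ExpLE n d) ≤ (n + d).choose n := by
  have e := Sym.equivNatSumOfFintype (Fin (n + 1)) d
  let F : ExpLE n d → {P : Fin (n + 1) → ℕ // ∑ i, P i = d} := fun α =>
    ⟨Fin.cons (d - ∑ i, α.1 i) α.1, by
      have := α.degree_le
      rw [Fin.sum_univ_succ]
      simp only [Fin.cons_zero, Fin.cons_succ]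
      omega⟩
  have hF : Function.Injective F := by
    intro α β h
    refine Subtype.ext (Finsupp.ext fun i => ?_)
    simpa [F] using congrFun (congrArg Subtype.val h) i.succ
  have h := Fintype.card_le_of_injective _ (e.symm.injective.comp hF)
  rw [Sym.card_sym_eq_choose, Fintype.card_fin] at h
  rwa [show n + 1 + d - 1 = n + d by omega, ← Nat.choose_symm_add] at h

theorem card_expLE_coord_eq_zero_le (n d : ℕ) (i : Fin n) :
    (Finset.univ.filter fun α : ExpLE n d => α.1 i = 0).card ≤ (d + 1) ^ (n - 1) := by
  classical
  let F : {α : ExpLE n d // α.1 i = 0} → {j : Fin n // j ≠ i} → Fin (d + 1) := fun α j =>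
    ⟨α.1.1 j, Nat.lt_succ_of_le
      ((Finset.single_le_sum (f := fun j => α.1.1 j) (fun _ _ => Nat.zero_le _)
        (Finset.mem_univ _)).trans α.1.degree_le)⟩
  have hF : Function.Injective F := by
    intro α β h
    refine Subtype.ext (Subtype.ext (Finsupp.ext fun j => ?_))
    by_cases hj : j = i
    · subst hj; rw [α.2, β.2]
    · simpa [F] using congrFun h ⟨j, hj⟩
  have h := Fintype.card_le_of_injective F hF
  rw [← Fintype.card_subtype]
  simpa [Fintype.card_subtype_compl] using h

/-- The weight `∑ᵢ i·αᵢ` of an exponent vector. -/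
def expWeight (a : Fin n →₀ ℕ) : ℕ := ∑ i : Fin n, (i : ℕ) * a i

theorem expWeight_add_single (a : Fin n →₀ ℕ) (k : Fin n) :
    expWeight (a + Finsupp.single k 1) = expWeight a + k := by
  simp [expWeight, mul_add, Finset.sum_add_distrib, Finsupp.single_apply]

theorem sum_add_single (a : Fin n →₀ ℕ) (k : Fin n) :
    ∑ i, (a + Finsupp.single k 1 : Fin n →₀ ℕ) i = ∑ i, a i + 1 := by
  simp [Finset.sum_add_distrib, Finsupp.single_apply]

theorem mul_card_dvd_expWeight_le (n d : ℕ) :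
    n * (Finset.univ.filter fun α : ExpLE n d => n ∣ expWeight α.1).card ≤
      Fintype.card (ExpLE n (d + 1)) := by
  let F : Fin n × {α : ExpLE n d // n ∣ expWeight α.1} → ExpLE n (d + 1) := fun p =>
    ExpLE.ofLE (p.2.1.1 + Finsupp.single p.1 1)
      (by rw [sum_add_single]; exact Nat.succ_le_succ p.2.1.degree_le)
  have hF : Function.Injective F := by
    rintro ⟨i, α, hα⟩ ⟨j, β, hβ⟩ h
    have h1 : α.1 + Finsupp.single i 1 = β.1 + Finsupp.single j 1 := congrArg Subtype.val h
    have hw : ∀ (γ : ExpLE n d) (k : Fin n), n ∣ expWeight γ.1 →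
        expWeight (γ.1 + Finsupp.single k 1) % n = k := by
      rintro γ k ⟨c, hc⟩
      rw [expWeight_add_single, hc, Nat.mul_add_mod, Nat.mod_eq_of_lt k.2]
    obtain rfl : i = j := Fin.ext (by rw [← hw α i hα, ← hw β j hβ, h1])
    obtain rfl : α = β := Subtype.ext (add_right_cancel h1)
    rfl
  have h := Fintype.card_le_of_injective F hF
  rwa [Fintype.card_prod, Fintype.card_fin, Fintype.card_subtype] at h

/-- The monomials used in the construction: those of weight divisible by `n`, together with
those not divisible by some variable. -/
def InSkeleton (a : Fin n →₀ ℕ) : Prop := n ∣ expWeight a ∨ ∃ i, a i = 0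

open Classical in
theorem mul_card_skeleton_le (n d : ℕ) :
    n * Fintype.card {α : ExpLE n d // InSkeleton α.1} ≤
      (n + (d + 1)).choose n + n * (n * (d + 1) ^ (n - 1)) := by
  have h : Fintype.card {α : ExpLE n d // InSkeleton α.1} ≤
      (Finset.univ.filter fun α : ExpLE n d => n ∣ expWeight α.1).card +
        n * (d + 1) ^ (n - 1) := by
    rw [Fintype.card_subtype]
    calc _ ≤ ((Finset.univ.filter fun α : ExpLE n d => n ∣ expWeight α.1) ∪
          Finset.univ.biUnion fun i : Fin n =>
            Finset.univ.filter fun α : ExpLE n d => α.1 i = 0).card :=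
          Finset.card_le_card fun α hα => by
            have hα : InSkeleton α.1 := (Finset.mem_filter.1 hα).2
            simpa [InSkeleton] using hα
      _ ≤ _ := (Finset.card_union_le _ _).trans (Nat.add_le_add_left
          ((Finset.card_biUnion_le_card_mul _ _ _
            fun i _ => card_expLE_coord_eq_zero_le n d i).trans (by simp)) _)
  calc _ ≤ n * _ := Nat.mul_le_mul_left n h
    _ ≤ _ := by
      rw [mul_add]
      exact Nat.add_le_add_right
        ((mul_card_dvd_expWeight_le n d).trans (card_expLE_le_choose n (d + 1))) _

theorem exists_add_pow_le (c : ℝ) (hc : 0 ≤ c) (k : ℕ) :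
    ∃ C : ℝ, 0 ≤ C ∧ ∀ x : ℝ, 1 ≤ x → (x + c) ^ (k + 1) ≤ x ^ (k + 1) + C * x ^ k := by
  induction k with
  | zero => exact ⟨c, hc, fun x _ => by simp⟩
  | succ k ih =>
    obtain ⟨C, hC, h⟩ := ih
    refine ⟨c + C + c * C, by positivity, fun x hx => ?_⟩
    have hx0 : 0 ≤ x := by linarith
    have hk : c * C * x ^ k ≤ c * C * x ^ (k + 1) :=
      mul_le_mul_of_nonneg_left (pow_le_pow_right₀ hx (Nat.le_succ k)) (by positivity)
    calc (x + c) ^ (k + 1 + 1) = (x + c) ^ (k + 1) * (x + c) := pow_succ _ _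
      _ ≤ (x ^ (k + 1) + C * x ^ k) * (x + c) :=
          mul_le_mul_of_nonneg_right (h x hx) (by positivity)
      _ = x ^ (k + 1 + 1) + (c + C) * x ^ (k + 1) + c * C * x ^ k := by ring
      _ ≤ _ := by linarith

open Classical in
theorem exists_card_skeleton_le (hn : 1 ≤ n) :
    ∃ C : ℝ, 0 < C ∧ ∀ d : ℕ, 1 ≤ d →
      (Fintype.card {α : ExpLE n d // InSkeleton α.1} : ℝ) ≤
        (d : ℝ) ^ n / ((n * n.factorial : ℕ) : ℝ) + C * (d : ℝ) ^ (n - 1) := by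
  obtain ⟨k, rfl⟩ : ∃ k, n = k + 1 := ⟨n - 1, by omega⟩
  obtain ⟨C, hC, h⟩ := exists_add_pow_le ((k : ℝ) + 2) (by positivity) k
  refine ⟨C + (k + 1) * 2 ^ k, by positivity, fun d hd => ?_⟩
  have hd' : (1 : ℝ) ≤ d := by exact_mod_cast hd
  have h1 : (k + 1 : ℝ) * Fintype.card {α : ExpLE (k + 1) d // InSkeleton α.1} ≤
      ((k + 1 + (d + 1)).choose (k + 1) : ℕ) +
      (k + 1) * ((k + 1) * (d + 1) ^ k) := by
    exact_mod_cast mul_card_skeleton_le (k + 1) d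
  have h2 : (((k + 1 + (d + 1)).choose (k + 1) : ℕ) : ℝ) ≤
      ((d : ℝ) ^ (k + 1) + C * (d : ℝ) ^ k) / (k + 1).factorial := by
    refine (Nat.choose_le_pow_div _ _).trans ?_
    gcongr
    refine le_trans (le_of_eq ?_) (h d hd')
    push_cast
    ring
  have h3 : ((d : ℝ) + 1) ^ k ≤ 2 ^ k * (d : ℝ) ^ k := by
    rw [← mul_pow]
    gcongr
    linarith
  have hfac : (1 : ℝ) ≤ (k + 1).factorial := by exact_mod_cast Nat.factorial_pos (k + 1)
  have hCd : C * (d : ℝ) ^ k / (k + 1).factorial ≤ (k + 1) * (C * (d : ℝ) ^ k) := by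
    have h0 : 0 ≤ C * (d : ℝ) ^ k := by positivity
    refine (div_le_self h0 hfac).trans (le_mul_of_one_le_left h0 ?_)
    have : (0 : ℝ) ≤ k := Nat.cast_nonneg k
    linarith
  refine le_of_mul_le_mul_left ?_ (show (0 : ℝ) < k + 1 by positivity)
  calc (k + 1 : ℝ) * Fintype.card {α : ExpLE (k + 1) d // InSkeleton α.1}
      ≤ ((d : ℝ) ^ (k + 1) + C * (d : ℝ) ^ k) / (k + 1).factorial +
        (k + 1) * ((k + 1) * (2 ^ k * (d : ℝ) ^ k)) := by
        refine h1.trans (add_le_add h2 ?_)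
        gcongr
    _ = (d : ℝ) ^ (k + 1) / (k + 1).factorial + C * (d : ℝ) ^ k / (k + 1).factorial +
        (k + 1) * ((k + 1) * (2 ^ k * (d : ℝ) ^ k)) := by rw [add_div]
    _ ≤ (d : ℝ) ^ (k + 1) / (k + 1).factorial + (k + 1) * (C * (d : ℝ) ^ k) +
        (k + 1) * ((k + 1) * (2 ^ k * (d : ℝ) ^ k)) := by gcongr
    _ = _ := by
      rw [Nat.add_sub_cancel]
      push_cast
      field_simp
      ring

end Counting

section Skeleton

variable {n d : ℕ}

theorem exists_eq_add_single {a : Fin n →₀ ℕ} {k : Fin n} (h : a k ≠ 0) :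
    ∃ b, a = b + Finsupp.single k 1 :=
  ⟨a - Finsupp.single k 1, (tsub_add_cancel_of_le
    (Finsupp.single_le_iff.2 (Nat.one_le_iff_ne_zero.2 h))).symm⟩

theorem InSkeleton.exists_pred [NeZero n] {a : Fin n →₀ ℕ} (ha : InSkeleton a) (h0 : a ≠ 0) :
    ∃ b k, InSkeleton b ∧ a = b + Finsupp.single k 1 := by
  by_cases h : a 0 = 0
  · obtain ⟨k, hk⟩ := Finsupp.ne_iff.1 h0
    obtain ⟨b, rfl⟩ := exists_eq_add_single hk
    exact ⟨b, k, Or.inr ⟨0, (Nat.add_eq_zero_iff.1 h).1⟩, rfl⟩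
  · obtain ⟨b, rfl⟩ := exists_eq_add_single h
    refine ⟨b, 0, ?_, rfl⟩
    rcases ha with ha | ⟨i, hi⟩
    · rw [expWeight_add_single] at ha
      exact Or.inl (by simpa using ha)
    · exact Or.inr ⟨i, (Nat.add_eq_zero_iff.1 hi).1⟩

theorem exists_inSkeleton_cover [NeZero n] (a : Fin n →₀ ℕ) :
    ∃ b, InSkeleton b ∧ (a = b ∨ ∃ k, a = b + Finsupp.single k 1) := by
  let k : Fin n := ⟨expWeight a % n, Nat.mod_lt _ (NeZero.pos n)⟩
  by_cases h : a k = 0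
  · exact ⟨a, Or.inr ⟨k, h⟩, Or.inl rfl⟩
  · obtain ⟨b, hb⟩ := exists_eq_add_single h
    refine ⟨b, Or.inl ?_, Or.inr ⟨k, hb⟩⟩
    have h1 : expWeight a = expWeight b + expWeight a % n :=
      (congrArg expWeight hb).trans (expWeight_add_single b k)
    have h2 := Nat.dvd_sub_mod (n := n) (expWeight a)
    rwa [show expWeight a - expWeight a % n = expWeight b by omega] at h2

end Skeleton

/-- Theorem 4.5, construction part. For fixed `n ≥ 1` there is a constant
`C > 0` such that for every `d ≥ 1` there is a uniform determinantal representation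
`M = M₀ + M₁` of `p_{n,d}` of size `N ≤ dⁿ/(n·n!) + C·d^{n-1}` whose constant part `M₀`
(obtained by setting all `c_α` to zero) is annihilated on the left by some fixed nonzero
vector `u ∈ Kᴺ`, i.e. the singular space spanned by the coefficient matrices of `M₀` is a
compression space with a one-dimensional witness. -/
theorem udr_first_construction (K : Type*) [Field K] (n : ℕ) (hn : 1 ≤ n) :
    ∃ C : ℝ, 0 < C ∧ ∀ d : ℕ, 1 ≤ d →
      ∃ (N : ℕ) (M : Matrix (Fin N) (Fin N) (URing K n d)),
        IsUDR K n d N M ∧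
        (N : ℝ) ≤ (d : ℝ) ^ n / ((n * n.factorial : ℕ) : ℝ) + C * (d : ℝ) ^ (n - 1) ∧
        ∃ u : Fin N → K, u ≠ 0 ∧
          Matrix.vecMul (fun i => (MvPolynomial.C (u i) : MvPolynomial (Fin n) K))
            (M.map (killC K n d)) = 0 := by
  classical
  have : NeZero n := ⟨by omega⟩
  obtain ⟨C, hC, h⟩ := exists_card_skeleton_le hn
  refine ⟨C, hC, fun d hd => ?_⟩
  have hle : ∀ (α : ExpLE n d) (b : Fin n →₀ ℕ) (k : Fin n),
      α.1 = b + Finsupp.single k 1 → ∑ i, b i ≤ d := by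
    intro α b k hk
    have h1 := α.degree_le
    rw [hk, sum_add_single] at h1
    omega
  obtain ⟨M, hM, hu⟩ := exists_isUDR_of_connected_cover K (d := d)
    (ι := {α : ExpLE n d // InSkeleton α.1}) (fun α => α.1.1)
    ⟨ExpLE.ofLE 0 (by simp), Or.inr ⟨0, rfl⟩⟩ rfl
    (by
      rintro ⟨α, hα⟩ h0
      obtain ⟨b, k, hb, e⟩ := hα.exists_pred fun h => h0 (Subtype.ext (Subtype.ext h))
      exact ⟨⟨ExpLE.ofLE b (hle α b k e), hb⟩, k, e⟩)
    (by
      intro α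
      obtain ⟨b, hb, e | ⟨k, e⟩⟩ := exists_inSkeleton_cover α.1
      · exact ⟨⟨α, e ▸ hb⟩, Or.inl rfl⟩
      · exact ⟨⟨ExpLE.ofLE b (hle α b k e), hb⟩, Or.inr ⟨k, e⟩⟩)
  exact ⟨_, M, hM, h d hd, hu⟩
end
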